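/- arXiv:2308.02157 — 3 statements merged into one kernel-verified Lean document; each statement's English description precedes it below -/
import Mathlib

section
/- (First-order global error bound / Theorem 1) Let g : ℝ^d × ℝ → ℝ^d satisfy ‖g(x₁, λ) − g(x₂, λ)‖ ≤ L ‖x₁ − x₂‖ for all x₁, x₂ ∈ ℝ^d and all λ ∈ [λ_min, λ_max], let x : [λ_min, λ_max] → ℝ^d solve x'(λ) = −x(λ) + g(x(λ), λ), and assume f(λ) := g(x(λ), λ) is continuously differentiable. Then there is a constant C, depending only on L and λ_max − λ_min (not on the grid), such that for every grid λ_min = λ_0 < λ_1 < … < λ_N = λ_max with steps h_n := λ_{n+1} − λ_n and h := max_n h_n, the exponential Euler iterates x_0 := x(λ_0), x_{n+1} := e^{−h_n} x_n + (1 − e^{−h_n}) g(x_n, λ_n) satisfy ‖x_n − x(λ_n)‖ ≤ C h · sup_{λ_min ≤ λ ≤ λ_max} ‖f'(λ)‖ for all 0 ≤ n ≤ N. -/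
open MeasureTheory

theorem Real.le_biSup {ι : Type*} {p : ι → Prop} {f : ι → ℝ} {B : ℝ} (hB : ∀ i, p i → f i ≤ B)
    {i : ι} (hi : p i) : f i ≤ ⨆ (j) (_ : p j), f j := by
  have hbdd : BddAbove (Set.range fun j => ⨆ _ : p j, f j) := by
    refine ⟨max B 0, ?_⟩
    rintro _ ⟨j, rfl⟩
    exact Real.iSup_le (fun hj => (hB j hj).trans (le_max_left _ _)) (le_max_right _ _)
  refine le_ciSup_of_le hbdd i ?_
  simp [hi]

/-- Local truncation error of the exponential Euler step for `x' = -x + f`. -/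
theorem norm_exponentialEuler_defect_le {E : Type*} [NormedAddCommGroup E] [NormedSpace ℝ E]
    {x f : ℝ → E} {a b M : ℝ} (hab : a ≤ b)
    (hx : ∀ s ∈ Set.Icc a b, HasDerivWithinAt x (-x s + f s) (Set.Icc a b) s)
    (hf : ∀ s ∈ Set.Icc a b, ‖f s - f a‖ ≤ M * (s - a)) (hM : 0 ≤ M) :
    ‖x b - (Real.exp (-(b - a)) • x a + (1 - Real.exp (-(b - a))) • f a)‖ ≤
      (b - a) * (b - a) * M := by
  have hderiv : ∀ s ∈ Set.Icc a b, HasDerivWithinAt (fun u => Real.exp (u - b) • (x u - f a))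
      (Real.exp (s - b) • (f s - f a)) (Set.Icc a b) s := by
    intro s hs
    have he : HasDerivWithinAt (fun u => Real.exp (u - b)) (Real.exp (s - b)) (Set.Icc a b) s := by
      simpa using (((hasDerivAt_id s).sub_const b).exp).hasDerivWithinAt
    refine (he.smul ((hx s hs).sub_const (f a))).congr_deriv ?_
    module
  have hbound : ∀ s ∈ Set.Icc a b, ‖Real.exp (s - b) • (f s - f a)‖ ≤ M * (b - a) := by
    intro s hs
    rw [norm_smul, Real.norm_of_nonneg (Real.exp_pos _).le]
    calc Real.exp (s - b) * ‖f s - f a‖ ≤ 1 * (M * (b - a)) := by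
          gcongr
          · exact Real.exp_le_one_iff.2 (by linarith [hs.2])
          · exact (hf s hs).trans (by gcongr; exact hs.2)
      _ = M * (b - a) := one_mul _
  have h := (convex_Icc a b).norm_image_sub_le_of_norm_hasDerivWithin_le hderiv hbound
    (Set.left_mem_Icc.2 hab) (Set.right_mem_Icc.2 hab)
  rw [Real.norm_of_nonneg (sub_nonneg.2 hab)] at h
  calc _ = ‖Real.exp (b - b) • (x b - f a) - Real.exp (a - b) • (x a - f a)‖ := by
        rw [sub_self, Real.exp_zero, neg_sub]
        congr 1
        module
    _ ≤ M * (b - a) * (b - a) := h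
    _ = _ := by ring

/-- Error propagation over one exponential Euler step. -/
theorem norm_exponentialEuler_step_sub_le {E : Type*} [NormedAddCommGroup E] [NormedSpace ℝ E]
    {h K δ : ℝ} (hh : 0 ≤ h) {X x y u v : E} (huv : ‖u - v‖ ≤ K * ‖X - x‖)
    (hy : ‖y - (Real.exp (-h) • x + (1 - Real.exp (-h)) • v)‖ ≤ δ) :
    ‖Real.exp (-h) • X + (1 - Real.exp (-h)) • u - y‖ ≤ Real.exp (K * h) * ‖X - x‖ + δ := by
  have he1 : Real.exp (-h) ≤ 1 := Real.exp_le_one_iff.2 (by linarith)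
  have heh : 1 - Real.exp (-h) ≤ h := by linarith [Real.add_one_le_exp (-h)]
  calc _ = ‖(Real.exp (-h) • (X - x) + (1 - Real.exp (-h)) • (u - v)) -
        (y - (Real.exp (-h) • x + (1 - Real.exp (-h)) • v))‖ := by
        congr 1
        module
    _ ≤ ‖Real.exp (-h) • (X - x)‖ + ‖(1 - Real.exp (-h)) • (u - v)‖ + δ :=
        (norm_sub_le _ _).trans (add_le_add (norm_add_le _ _) hy)
    _ ≤ 1 * ‖X - x‖ + h * (K * ‖X - x‖) + δ := by
        rw [norm_smul, norm_smul, Real.norm_of_nonneg (Real.exp_pos _).le,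
          Real.norm_of_nonneg (sub_nonneg.2 he1)]
        gcongr
    _ = (K * h + 1) * ‖X - x‖ + δ := by ring
    _ ≤ _ := by
        gcongr
        exact Real.add_one_le_exp _

/-- Discrete Grönwall inequality on a grid `t`. -/
theorem discrete_gronwall_grid {N : ℕ} {t e : ℕ → ℝ} {K B : ℝ} (hK : 0 ≤ K) (hB : 0 ≤ B)
    (ht : ∀ n < N, t n ≤ t (n + 1)) (he0 : e 0 ≤ 0)
    (he : ∀ n < N, e (n + 1) ≤ Real.exp (K * (t (n + 1) - t n)) * e n + (t (n + 1) - t n) * B) :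
    ∀ n ≤ N, e n ≤ Real.exp (K * (t n - t 0)) * (t n - t 0) * B := by
  intro n hn
  suffices h : t 0 ≤ t n ∧ e n ≤ Real.exp (K * (t n - t 0)) * (t n - t 0) * B from h.2
  induction n with
  | zero => simpa using he0
  | succ n ih =>
    obtain ⟨h0, ih⟩ := ih (by omega)
    have hstep := ht n hn
    refine ⟨h0.trans hstep, (he n hn).trans ?_⟩
    have hexp : 1 ≤ Real.exp (K * (t (n + 1) - t 0)) :=
      Real.one_le_exp (mul_nonneg hK (by linarith))
    have hinc : (t (n + 1) - t n) * B ≤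
        Real.exp (K * (t (n + 1) - t 0)) * ((t (n + 1) - t n) * B) :=
      le_mul_of_one_le_left (mul_nonneg (by linarith) hB) hexp
    calc _ ≤ Real.exp (K * (t (n + 1) - t n)) * (Real.exp (K * (t n - t 0)) * (t n - t 0) * B) +
          Real.exp (K * (t (n + 1) - t 0)) * ((t (n + 1) - t n) * B) := by gcongr
      _ = Real.exp (K * (t (n + 1) - t n) + K * (t n - t 0)) * (t n - t 0) * B +
          Real.exp (K * (t (n + 1) - t 0)) * ((t (n + 1) - t n) * B) := by
          rw [Real.exp_add]
          ring
      _ = _ := by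
          rw [show K * (t (n + 1) - t n) + K * (t n - t 0) = K * (t (n + 1) - t 0) by ring]
          ring

/-- **First-order global error bound for exponential Euler (Theorem 1).**
There is a constant `C`, depending only on `L` and `λ_max - λ_min` (in particular not on the
grid, the dimension, `g` or `x`), such that for every Lipschitz-in-`x` nonlinearity `g`, every
solution `x` of `dx/dλ = -x + g(x, λ)` with `f(λ) := g(x(λ), λ)` continuously differentiable,
and every grid `λ_min = λ_0 < … < λ_N = λ_max`, the exponential Euler iterates
`X_0 := x(λ_0)`, `X_{n+1} := e^{-h_n} X_n + (1 - e^{-h_n}) g(X_n, λ_n)` satisfy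
`‖X_n - x(λ_n)‖ ≤ C h sup_{λ∈[λ_min,λ_max]} ‖f'(λ)‖` with `h := max_n h_n`. -/
theorem stmt_9 (L lmin lmax : ℝ) (hlt : lmin < lmax) :
    ∃ C : ℝ, ∀ (d : ℕ)
      (g : EuclideanSpace ℝ (Fin d) → ℝ → EuclideanSpace ℝ (Fin d))
      (x : ℝ → EuclideanSpace ℝ (Fin d)),
      (∀ (x1 x2 : EuclideanSpace ℝ (Fin d)), ∀ lam ∈ Set.Icc lmin lmax,
        ‖g x1 lam - g x2 lam‖ ≤ L * ‖x1 - x2‖) →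
      (∀ lam ∈ Set.Icc lmin lmax,
        HasDerivWithinAt x (-x lam + g (x lam) lam) (Set.Icc lmin lmax) lam) →
      ContDiffOn ℝ 1 (fun lam => g (x lam) lam) (Set.Icc lmin lmax) →
      ∀ (N : ℕ) (t : ℕ → ℝ), 0 < N → t 0 = lmin → t N = lmax →
      (∀ n < N, t n < t (n + 1)) →
      ∀ X : ℕ → EuclideanSpace ℝ (Fin d), X 0 = x (t 0) →
      (∀ n < N, X (n + 1) = Real.exp (-(t (n + 1) - t n)) • X n +
        (1 - Real.exp (-(t (n + 1) - t n))) • g (X n) (t n)) →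
      ∀ n ≤ N, ‖X n - x (t n)‖ ≤
        C * (⨆ m ∈ Finset.range N, (t (m + 1) - t m)) *
          ⨆ lam ∈ Set.Icc lmin lmax,
            ‖derivWithin (fun u => g (x u) u) (Set.Icc lmin lmax) lam‖ := by
  refine ⟨Real.exp (max L 0 * (lmax - lmin)) * (lmax - lmin), ?_⟩
  intro d g x hg hx hf N t _ ht0 htN ht X hX0 hX n hn
  set H := ⨆ m ∈ Finset.range N, (t (m + 1) - t m)
  set M := ⨆ lam ∈ Set.Icc lmin lmax,
    ‖derivWithin (fun u => g (x u) u) (Set.Icc lmin lmax) lam‖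
  have hmono : MonotoneOn t (Set.Iic N) := by
    refine monotoneOn_of_le_add_one Set.ordConnected_Iic fun m _ _ hm => ?_
    exact (ht m (Nat.lt_of_succ_le hm)).le
  have hmem : ∀ m ≤ N, t m ∈ Set.Icc lmin lmax := fun m hm =>
    ⟨ht0 ▸ hmono (Nat.zero_le N) hm (Nat.zero_le m), htN ▸ hmono hm (le_refl N) hm⟩
  have hstep : ∀ m < N, t (m + 1) - t m ≤ H := fun m hm =>
    Real.le_biSup (p := fun m => m ∈ Finset.range N) (f := fun m => t (m + 1) - t m)
      (B := lmax - lmin)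
      (fun j hj => by
        have hj := Finset.mem_range.1 hj
        linarith [(hmem j hj.le).1, (hmem (j + 1) hj).2])
      (Finset.mem_range.2 hm)
  obtain ⟨B, hB⟩ := isCompact_Icc.exists_bound_of_continuousOn
    (hf.continuousOn_derivWithin (uniqueDiffOn_Icc hlt) le_rfl)
  have hderiv : ∀ s ∈ Set.Icc lmin lmax,
      ‖derivWithin (fun u => g (x u) u) (Set.Icc lmin lmax) s‖ ≤ M := fun s hs =>
    Real.le_biSup (p := fun s => s ∈ Set.Icc lmin lmax) hB hs
  have hM0 : 0 ≤ M := (norm_nonneg _).trans (hderiv lmin (Set.left_mem_Icc.2 hlt.le))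
  have hH0 : 0 ≤ H :=
    Real.iSup_nonneg fun m => Real.iSup_nonneg fun hm =>
      (sub_pos.2 (ht m (Finset.mem_range.1 hm))).le
  have hfLip : ∀ a ∈ Set.Icc lmin lmax, ∀ s ∈ Set.Icc lmin lmax, a ≤ s →
      ‖g (x s) s - g (x a) a‖ ≤ M * (s - a) := fun a ha s hs has => by
    have h := (convex_Icc lmin lmax).norm_image_sub_le_of_norm_derivWithin_le
      (hf.differentiableOn one_ne_zero) hderiv ha hs
    rwa [Real.norm_of_nonneg (sub_nonneg.2 has)] at h
  have hrec : ∀ m < N, ‖X (m + 1) - x (t (m + 1))‖ ≤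
      Real.exp (max L 0 * (t (m + 1) - t m)) * ‖X m - x (t m)‖ +
        (t (m + 1) - t m) * (H * M) := fun m hm => by
    have hle := (ht m hm).le
    have hsub : Set.Icc (t m) (t (m + 1)) ⊆ Set.Icc lmin lmax :=
      Set.Icc_subset_Icc (hmem m hm.le).1 (hmem (m + 1) hm).2
    rw [hX m hm]
    refine norm_exponentialEuler_step_sub_le (sub_nonneg.2 hle)
      ((hg _ _ _ (hmem m hm.le)).trans
        (mul_le_mul_of_nonneg_right (le_max_left L 0) (norm_nonneg _))) ?_
    refine (norm_exponentialEuler_defect_le (f := fun u => g (x u) u) hle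
      (fun s hs => (hx s (hsub hs)).mono hsub)
      (fun s hs => hfLip _ (hmem m hm.le) s (hsub hs) hs.1) hM0).trans ?_
    rw [mul_assoc]
    have := hstep m hm
    have := sub_nonneg.2 hle
    gcongr
  refine (discrete_gronwall_grid (e := fun m => ‖X m - x (t m)‖) (le_max_right L 0)
    (mul_nonneg hH0 hM0) (fun m hm => (ht m hm).le) (by simp [hX0]) hrec n hn).trans ?_
  rw [ht0, mul_assoc _ H M]
  have hn_mem := hmem n hn
  have := sub_nonneg.2 hn_mem.1
  gcongr
  · exact hn_mem.2
  · exact hn_mem.2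
end

section
/- (Second-order global error bound / Theorem 2) Let g : ℝ^d × ℝ → ℝ^d satisfy ‖g(x₁, λ) − g(x₂, λ)‖ ≤ L ‖x₁ − x₂‖ for all x₁, x₂ ∈ ℝ^d and all λ ∈ [λ_min, λ_max], let x : [λ_min, λ_max] → ℝ^d solve x'(λ) = −x(λ) + g(x(λ), λ), assume f(λ) := g(x(λ), λ) is twice continuously differentiable, and fix c₂ ∈ (0, 1]. Then there is a constant C, depending only on L, c₂ and λ_max − λ_min, such that for every grid λ_min = λ_0 < … < λ_N = λ_max with steps h_n and h := max_n h_n, the two-stage iterates x_0 := x(λ_0), x_{n,2} := e^{−c₂ h_n} x_n + c₂ h_n φ_1(−c₂ h_n) g(x_n, λ_n), x_{n+1} := e^{−h_n} x_n + h_n [ (φ_1(−h_n) − φ_2(−h_n)/c₂) g(x_n, λ_n) + (φ_2(−h_n)/c₂) g(x_{n,2}, λ_n + c₂ h_n) ] satisfy ‖x_n − x(λ_n)‖ ≤ C h² ( sup_{λ_min ≤ λ ≤ λ_max} ‖f'(λ)‖ + sup_{λ_min ≤ λ ≤ λ_max} ‖f''(λ)‖ ) for all 0 ≤ n ≤ N.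 -/
open MeasureTheory

/-- `phi j h` denotes `φ_j(-h) = h^{-j} ∫_0^h e^{τ-h} τ^{j-1}/(j-1)! dτ` for `j ≥ 1`,
with `φ_0(-h) := e^{-h}` (and the convention `φ_j(0) := 1/j!`). -/
noncomputable def phi (j : ℕ) (h : ℝ) : ℝ :=
  if h = 0 then 1 / (Nat.factorial j : ℝ)
  else if j = 0 then Real.exp (-h)
  else (1 / h ^ j) *
    ∫ τ in (0:ℝ)..h, Real.exp (τ - h) * τ ^ (j - 1) / (Nat.factorial (j - 1) : ℝ)

/-- The closed form of `φ₁` away from `0`. -/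
lemma mul_phi_one {h : ℝ} (hh : 0 < h) : h * phi 1 h = 1 - Real.exp (-h) := by
  have key : ∫ τ in (0:ℝ)..h, Real.exp (τ - h) = Real.exp (h - h) - Real.exp (0 - h) := by
    refine intervalIntegral.integral_eq_sub_of_hasDerivAt (f := fun τ => Real.exp (τ - h))
      (fun τ _ => ?_) ?_
    · simpa using ((hasDerivAt_id τ).sub_const h).exp
    · exact (by fun_prop : Continuous fun τ : ℝ => Real.exp (τ - h)).intervalIntegrable _ _
  have hne := hh.ne'
  simp only [phi, hne, if_false, one_ne_zero, pow_one, Nat.sub_self, pow_zero, mul_one,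
    Nat.factorial_zero, Nat.cast_one, div_one, key]
  simp only [sub_self, Real.exp_zero, zero_sub]
  field_simp

/-- The closed form of `φ₂` away from `0`. -/
lemma sq_mul_phi_two {h : ℝ} (hh : 0 < h) : h ^ 2 * phi 2 h = h - 1 + Real.exp (-h) := by
  have key : ∫ τ in (0:ℝ)..h, Real.exp (τ - h) * τ =
      Real.exp (h - h) * (h - 1) - Real.exp (0 - h) * (0 - 1) := by
    refine intervalIntegral.integral_eq_sub_of_hasDerivAt
      (f := fun τ => Real.exp (τ - h) * (τ - 1)) (fun τ _ => ?_) ?_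
    · have := ((hasDerivAt_id τ).sub_const h).exp.mul ((hasDerivAt_id τ).sub_const 1)
      refine this.congr_deriv ?_
      simp only [id]
      ring
    · exact (by fun_prop : Continuous fun τ : ℝ => Real.exp (τ - h) * τ).intervalIntegrable _ _
  have hne := hh.ne'
  simp only [phi, hne, if_false, two_ne_zero, Nat.add_one_sub_one, pow_one,
    Nat.factorial_one, Nat.cast_one, div_one, key]
  simp only [sub_self, Real.exp_zero, zero_sub]
  field_simp
  ring

lemma mul_phi_two_nonneg {h : ℝ} (hh : 0 < h) : 0 ≤ h * phi 2 h := by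
  have h1 := sq_mul_phi_two hh
  have h2 := Real.add_one_le_exp (-h)
  nlinarith

lemma mul_phi_two_le {h : ℝ} (hh : 0 < h) : h * phi 2 h ≤ h := by
  have h1 := sq_mul_phi_two hh
  have h2 : Real.exp (-h) * (1 + h) ≤ 1 := by
    have h3 := Real.add_one_le_exp h
    have h4 : Real.exp (-h) * Real.exp h = 1 := by rw [← Real.exp_add]; simp
    nlinarith [Real.exp_pos (-h)]
  have h5 : h - 1 + Real.exp (-h) ≤ h ^ 2 := by nlinarith [Real.exp_pos (-h)]
  nlinarith

section Local

variable {E : Type*} [NormedAddCommGroup E] [NormedSpace ℝ E]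

/-- Crude first-order Taylor bound from a bound on the second derivative. -/
lemma norm_sub_sub_smul_le {f f1 f2 : ℝ → E} {a b M : ℝ}
    (hf : ∀ u ∈ Set.Icc a b, HasDerivWithinAt f (f1 u) (Set.Icc a b) u)
    (hf1 : ∀ u ∈ Set.Icc a b, HasDerivWithinAt f1 (f2 u) (Set.Icc a b) u)
    (hM : ∀ u ∈ Set.Icc a b, ‖f2 u‖ ≤ M) {v : ℝ} (hv : v ∈ Set.Icc a b) :
    ‖f v - f a - (v - a) • f1 a‖ ≤ M * (v - a) ^ 2 := by
  have hM0 : 0 ≤ M := (norm_nonneg _).trans (hM v hv)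
  have hsub : Set.Icc a v ⊆ Set.Icc a b := Set.Icc_subset_Icc_right hv.2
  have h1 : ∀ u ∈ Set.Icc a b, ‖f1 u - f1 a‖ ≤ M * (u - a) :=
    norm_image_sub_le_of_norm_deriv_le_segment' hf1 fun u hu => hM u (Set.Ico_subset_Icc_self hu)
  have h2 := norm_image_sub_le_of_norm_deriv_le_segment' (f := fun u => f u - (u - a) • f1 a)
    (f' := fun u => f1 u - f1 a) (a := a) (b := v) (C := M * (v - a))
    (fun u hu => by
      refine (((hf u (hsub hu)).mono hsub).sub
        (((hasDerivWithinAt_id u (Set.Icc a v)).sub_const a).smul_const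
          (f1 a))).congr_deriv ?_
      rw [one_smul])
    (fun u hu => (h1 u (hsub (Set.Ico_subset_Icc_self hu))).trans
      (mul_le_mul_of_nonneg_left (by linarith [hu.2]) hM0)) v (Set.right_mem_Icc.2 hv.1)
  calc ‖f v - f a - (v - a) • f1 a‖ = ‖f v - (v - a) • f1 a - (f a - (a - a) • f1 a)‖ := by
        congr 1; simp; abel
    _ ≤ M * (v - a) * (v - a) := h2
    _ = M * (v - a) ^ 2 := by ring

/-- Variation of constants in integrated form: replacing the source `f` of `x' = -x + f` by a
function `p` with primitive `e^u p(u) = q'(u)` perturbs `x` by at most the length of the interval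
times the sup distance of `f` and `p`. -/
lemma norm_exp_step_sub_le {x f p q : ℝ → E} {a b ε : ℝ} (hab : a ≤ b)
    (hx : ∀ u ∈ Set.Icc a b, HasDerivWithinAt x (-x u + f u) (Set.Icc a b) u)
    (hq : ∀ u ∈ Set.Icc a b, HasDerivWithinAt q (Real.exp (u - a) • p u) (Set.Icc a b) u)
    (hfp : ∀ u ∈ Set.Icc a b, ‖f u - p u‖ ≤ ε) :
    ‖x b - Real.exp (-(b - a)) • (x a + (q b - q a))‖ ≤ ε * (b - a) := by
  have h2 := norm_image_sub_le_of_norm_deriv_le_segment'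
    (f := fun u => Real.exp (u - a) • x u - q u)
    (f' := fun u => Real.exp (u - a) • (f u - p u)) (a := a) (b := b)
    (C := Real.exp (b - a) * ε)
    (fun u hu => by
      have he : HasDerivWithinAt (fun u => Real.exp (u - a)) (Real.exp (u - a)) (Set.Icc a b) u := by
        simpa using ((hasDerivAt_id u).sub_const a).exp.hasDerivWithinAt
      refine ((he.smul (hx u hu)).sub (hq u hu)).congr_deriv ?_
      module)
    (fun u hu => by
      rw [norm_smul, Real.norm_of_nonneg (Real.exp_pos _).le]
      exact mul_le_mul (Real.exp_le_exp.2 (by linarith [hu.2]))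
        (hfp u (Set.Ico_subset_Icc_self hu)) (norm_nonneg _) (Real.exp_pos _).le)
    b (Set.right_mem_Icc.2 hab)
  have hee : Real.exp (-(b - a)) * Real.exp (b - a) = 1 := by rw [← Real.exp_add]; simp
  have h3 : x b - Real.exp (-(b - a)) • (x a + (q b - q a)) =
      Real.exp (-(b - a)) • (Real.exp (b - a) • x b - q b - (Real.exp (a - a) • x a - q a)) := by
    simp only [sub_self, Real.exp_zero, one_smul]
    rw [smul_sub, smul_sub, smul_smul, hee]
    module
  rw [h3, norm_smul, Real.norm_of_nonneg (Real.exp_pos _).le]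
  calc _ ≤ Real.exp (-(b - a)) * (Real.exp (b - a) * ε * (b - a)) :=
        mul_le_mul_of_nonneg_left h2 (Real.exp_pos _).le
    _ = Real.exp (-(b - a)) * Real.exp (b - a) * (ε * (b - a)) := by ring
    _ = ε * (b - a) := by rw [hee, one_mul]

/-- Local error of the exponential Euler step. -/
lemma norm_exp_euler_sub_le {x f f1 : ℝ → E} {a b M : ℝ} (hab : a ≤ b)
    (hx : ∀ u ∈ Set.Icc a b, HasDerivWithinAt x (-x u + f u) (Set.Icc a b) u)
    (hf : ∀ u ∈ Set.Icc a b, HasDerivWithinAt f (f1 u) (Set.Icc a b) u)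
    (hM : ∀ u ∈ Set.Icc a b, ‖f1 u‖ ≤ M) :
    ‖x b - (Real.exp (-(b - a)) • x a + (1 - Real.exp (-(b - a))) • f a)‖ ≤ M * (b - a) ^ 2 := by
  have hM0 : 0 ≤ M := (norm_nonneg _).trans (hM a (Set.left_mem_Icc.2 hab))
  have h := norm_exp_step_sub_le (p := fun _ => f a) (q := fun u => Real.exp (u - a) • f a)
    (ε := M * (b - a)) hab hx
    (fun u _ => by
      simpa using (((hasDerivAt_id u).sub_const a).exp.smul_const (f a)).hasDerivWithinAt)
    (fun u hu => (norm_image_sub_le_of_norm_deriv_le_segment' hf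
      (fun u hu => hM u (Set.Ico_subset_Icc_self hu)) u hu).trans
        (mul_le_mul_of_nonneg_left (by linarith [hu.2]) hM0))
  have hee : Real.exp (-(b - a)) * Real.exp (b - a) = 1 := by rw [← Real.exp_add]; simp
  calc _ = ‖x b - Real.exp (-(b - a)) • (x a + (Real.exp (b - a) • f a -
        Real.exp (a - a) • f a))‖ := by
        congr 2
        simp only [sub_self, Real.exp_zero, one_smul]
        rw [smul_add, smul_sub, smul_smul, hee]
        module
    _ ≤ M * (b - a) * (b - a) := h
    _ = M * (b - a) ^ 2 := by ring

/-- Local error of the exponential step that integrates affine sources exactly. -/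
lemma norm_exp_affine_sub_le {x f f1 f2 : ℝ → E} {a b M : ℝ} (hab : a ≤ b)
    (hx : ∀ u ∈ Set.Icc a b, HasDerivWithinAt x (-x u + f u) (Set.Icc a b) u)
    (hf : ∀ u ∈ Set.Icc a b, HasDerivWithinAt f (f1 u) (Set.Icc a b) u)
    (hf1 : ∀ u ∈ Set.Icc a b, HasDerivWithinAt f1 (f2 u) (Set.Icc a b) u)
    (hM : ∀ u ∈ Set.Icc a b, ‖f2 u‖ ≤ M) :
    ‖x b - (Real.exp (-(b - a)) • x a + (1 - Real.exp (-(b - a))) • f a +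
      (b - a - 1 + Real.exp (-(b - a))) • f1 a)‖ ≤ M * (b - a) ^ 3 := by
  have hM0 : 0 ≤ M := (norm_nonneg _).trans (hM a (Set.left_mem_Icc.2 hab))
  have h := norm_exp_step_sub_le (p := fun u => f a + (u - a) • f1 a)
    (q := fun u => Real.exp (u - a) • f a + (Real.exp (u - a) * (u - a - 1)) • f1 a)
    (ε := M * (b - a) ^ 2) hab hx
    (fun u _ => by
      have he : HasDerivAt (fun u => Real.exp (u - a)) (Real.exp (u - a)) u := by
        simpa using ((hasDerivAt_id u).sub_const a).exp
      have hl : HasDerivAt (fun u => u - a - 1) 1 u :=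
        ((hasDerivAt_id u).sub_const a).sub_const 1
      refine ((he.smul_const (f a)).add
        ((he.mul hl).smul_const (f1 a))).hasDerivWithinAt.congr_deriv ?_
      module)
    (fun u hu => by
      have := norm_sub_sub_smul_le hf hf1 hM hu
      rw [← sub_sub]
      refine this.trans (mul_le_mul_of_nonneg_left ?_ hM0)
      exact pow_le_pow_left₀ (by linarith [hu.1]) (by linarith [hu.2]) 2)
  have hee : Real.exp (-(b - a)) * Real.exp (b - a) = 1 := by rw [← Real.exp_add]; simp
  calc _ = ‖x b - Real.exp (-(b - a)) • (x a + (Real.exp (b - a) • f a +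
        (Real.exp (b - a) * (b - a - 1)) • f1 a -
        (Real.exp (a - a) • f a + (Real.exp (a - a) * (a - a - 1)) • f1 a)))‖ := by
        congr 2
        simp only [sub_self, Real.exp_zero, one_smul]
        rw [smul_add, smul_sub, smul_add, smul_smul, smul_smul, ← mul_assoc, hee]
        module
    _ ≤ M * (b - a) ^ 2 * (b - a) := h
    _ = M * (b - a) ^ 3 := by ring

/-- One step of the two-stage scheme: error propagation plus third-order local error. -/
lemma norm_res_step_sub_le {g : E → ℝ → E} {x f1 f2 : ℝ → E} {a h K c T M1 M2 : ℝ}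
    (hh : 0 < h) (hhT : h ≤ T) (hK : 0 ≤ K) (hc : c ∈ Set.Ioc (0:ℝ) 1)
    (hg : ∀ x1 x2, ∀ u ∈ Set.Icc a (a + h), ‖g x1 u - g x2 u‖ ≤ K * ‖x1 - x2‖)
    (hx : ∀ u ∈ Set.Icc a (a + h),
      HasDerivWithinAt x (-x u + g (x u) u) (Set.Icc a (a + h)) u)
    (hf : ∀ u ∈ Set.Icc a (a + h),
      HasDerivWithinAt (fun v => g (x v) v) (f1 u) (Set.Icc a (a + h)) u)
    (hf1 : ∀ u ∈ Set.Icc a (a + h), HasDerivWithinAt f1 (f2 u) (Set.Icc a (a + h)) u)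
    (hM1 : ∀ u ∈ Set.Icc a (a + h), ‖f1 u‖ ≤ M1)
    (hM2 : ∀ u ∈ Set.Icc a (a + h), ‖f2 u‖ ≤ M2) (X : E) :
    ‖Real.exp (-h) • X + h • ((phi 1 h - phi 2 h / c) • g X a + (phi 2 h / c) •
        g (Real.exp (-(c * h)) • X + (c * h * phi 1 (c * h)) • g X a) (a + c * h)) - x (a + h)‖ ≤
      (1 + ((1 + 1 / c) * K + K * (1 + K * T) / c) * h) * ‖X - x a‖ +
        (K + 2) * h ^ 3 * (M1 + M2) := by
  obtain ⟨hc0, hc1⟩ := hc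
  have hch : 0 < c * h := mul_pos hc0 hh
  have hchh : c * h ≤ h := by nlinarith
  have ha : a ∈ Set.Icc a (a + h) := ⟨le_rfl, by linarith⟩
  have hs : a + c * h ∈ Set.Icc a (a + h) := ⟨by linarith, by linarith⟩
  have hM10 : 0 ≤ M1 := (norm_nonneg _).trans (hM1 a ha)
  have hM20 : 0 ≤ M2 := (norm_nonneg _).trans (hM2 a ha)
  have hsub : Set.Icc a (a + c * h) ⊆ Set.Icc a (a + h) := Set.Icc_subset_Icc_right hs.2
  have hstage := norm_exp_euler_sub_le (a := a) (b := a + c * h) (f := fun v => g (x v) v)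
    (by linarith) (fun u hu => (hx u (hsub hu)).mono hsub)
    (fun u hu => (hf u (hsub hu)).mono hsub) (fun u hu => hM1 u (hsub hu))
  have hfull := norm_exp_affine_sub_le (a := a) (b := a + h) (f := fun v => g (x v) v)
    (by linarith) hx hf hf1 hM2
  have htaylor := norm_sub_sub_smul_le hf hf1 hM2 hs
  simp only [add_sub_cancel_left] at hstage hfull htaylor
  have hp1 := mul_phi_one hh
  have hp2 := sq_mul_phi_two hh
  have hw0 := mul_phi_two_nonneg hh
  have hw1 := mul_phi_two_le hh
  rw [mul_phi_one hch]
  set w := h * phi 2 h with hw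
  set e := ‖X - x a‖ with he
  have he0 : 0 ≤ e := norm_nonneg _
  have hexp {s : ℝ} (hs : 0 < s) : Real.exp (-s) ≤ 1 ∧ 1 - Real.exp (-s) ≤ s :=
    ⟨Real.exp_le_one_iff.2 (by linarith), by linarith [Real.add_one_le_exp (-s)]⟩
  have hga := hg X (x a) a ha
  set Y := Real.exp (-(c * h)) • X + (1 - Real.exp (-(c * h))) • g X a with hY
  have hYe : ‖Y - x (a + c * h)‖ ≤ (1 + K * T) * e + M1 * (c * h) ^ 2 := by
    have hsplit : Y - x (a + c * h) = Real.exp (-(c * h)) • (X - x a) +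
        (1 - Real.exp (-(c * h))) • (g X a - g (x a) a) -
        (x (a + c * h) - (Real.exp (-(c * h)) • x a +
          (1 - Real.exp (-(c * h))) • g (x a) a)) := by
      rw [hY]; module
    rw [hsplit]
    refine (norm_sub_le _ _).trans (add_le_add ((norm_add_le _ _).trans ?_) hstage)
    rw [norm_smul, norm_smul, Real.norm_of_nonneg (Real.exp_pos _).le,
      Real.norm_of_nonneg (sub_nonneg.2 (hexp hch).1)]
    have h1 : Real.exp (-(c * h)) * e ≤ 1 * e := mul_le_mul_of_nonneg_right (hexp hch).1 he0
    have h2 : (1 - Real.exp (-(c * h))) * ‖g X a - g (x a) a‖ ≤ T * (K * e) :=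
      mul_le_mul (((hexp hch).2.trans hchh).trans hhT) hga (norm_nonneg _) (by linarith)
    linarith
  have hgs := (hg Y (x (a + c * h)) _ hs).trans (mul_le_mul_of_nonneg_left hYe hK)
  have hsplit : Real.exp (-h) • X + h • ((phi 1 h - phi 2 h / c) • g X a + (phi 2 h / c) •
        g Y (a + c * h)) - x (a + h) =
      Real.exp (-h) • (X - x a) + (1 - Real.exp (-h)) • (g X a - g (x a) a) -
        (w / c) • (g X a - g (x a) a) +
        (w / c) • (g Y (a + c * h) - g (x (a + c * h)) (a + c * h)) +
        (w / c) • (g (x (a + c * h)) (a + c * h) - g (x a) a - (c * h) • f1 a) -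
        (x (a + h) - (Real.exp (-h) • x a + (1 - Real.exp (-h)) • g (x a) a +
          (h - 1 + Real.exp (-h)) • f1 a)) := by
    have hA : h * (phi 1 h - phi 2 h / c) = 1 - Real.exp (-h) - w / c := by
      rw [← hp1, hw]; ring
    have hB : h * (phi 2 h / c) = w / c := by rw [hw]; ring
    have hC : h - 1 + Real.exp (-h) = w / c * (c * h) := by
      rw [← hp2, hw]; field_simp
    rw [smul_add, smul_smul, smul_smul, hA, hB, hC]
    module
  have hwc0 : 0 ≤ w / c := div_nonneg hw0 hc0.le
  have hwc : w / c ≤ h / c := div_le_div_of_nonneg_right hw1 hc0.le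
  have hhc0 : 0 ≤ h / c := hwc0.trans hwc
  have b1 : ‖Real.exp (-h) • (X - x a)‖ ≤ e := by
    rw [norm_smul, Real.norm_of_nonneg (Real.exp_pos _).le]
    exact mul_le_of_le_one_left he0 (hexp hh).1
  have b2 : ‖(1 - Real.exp (-h)) • (g X a - g (x a) a)‖ ≤ h * (K * e) := by
    rw [norm_smul, Real.norm_of_nonneg (sub_nonneg.2 (hexp hh).1)]
    exact mul_le_mul (hexp hh).2 hga (norm_nonneg _) hh.le
  have b3 : ‖(w / c) • (g X a - g (x a) a)‖ ≤ h / c * (K * e) := by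
    rw [norm_smul, Real.norm_of_nonneg hwc0]
    exact mul_le_mul hwc hga (norm_nonneg _) hhc0
  have b4 : ‖(w / c) • (g Y (a + c * h) - g (x (a + c * h)) (a + c * h))‖ ≤
      h / c * (K * ((1 + K * T) * e + M1 * (c * h) ^ 2)) := by
    rw [norm_smul, Real.norm_of_nonneg hwc0]
    exact mul_le_mul hwc hgs (norm_nonneg _) hhc0
  have b5 : ‖(w / c) • (g (x (a + c * h)) (a + c * h) - g (x a) a - (c * h) • f1 a)‖ ≤
      h / c * (M2 * (c * h) ^ 2) := by
    rw [norm_smul, Real.norm_of_nonneg hwc0]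
    exact mul_le_mul hwc htaylor (norm_nonneg _) hhc0
  have hsum : ‖Real.exp (-h) • X + h • ((phi 1 h - phi 2 h / c) • g X a + (phi 2 h / c) •
        g Y (a + c * h)) - x (a + h)‖ ≤ e + h * (K * e) + h / c * (K * e) +
      h / c * (K * ((1 + K * T) * e + M1 * (c * h) ^ 2)) + h / c * (M2 * (c * h) ^ 2) +
      M2 * h ^ 3 := by
    rw [hsplit]
    refine (norm_sub_le _ _).trans (add_le_add ((norm_add_le _ _).trans (add_le_add
      ((norm_add_le _ _).trans (add_le_add ((norm_sub_le _ _).trans (add_le_add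
        ((norm_add_le _ _).trans (add_le_add b1 b2)) b3)) b4)) b5)) hfull)
  refine hsum.trans ?_
  have hrw : e + h * (K * e) + h / c * (K * e) +
      h / c * (K * ((1 + K * T) * e + M1 * (c * h) ^ 2)) + h / c * (M2 * (c * h) ^ 2) +
      M2 * h ^ 3 = (1 + ((1 + 1 / c) * K + K * (1 + K * T) / c) * h) * e +
        (c * (K * h ^ 3 * M1) + c * (h ^ 3 * M2) + h ^ 3 * M2) := by
    field_simp
    ring
  rw [hrw]
  have hh3 : 0 ≤ h ^ 3 := by positivity
  have k1 : c * (K * h ^ 3 * M1) ≤ K * h ^ 3 * M1 := mul_le_of_le_one_left (by positivity) hc1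
  have k2 : c * (h ^ 3 * M2) ≤ h ^ 3 * M2 := mul_le_of_le_one_left (by positivity) hc1
  have k3 : 0 ≤ h ^ 3 * M1 := by positivity
  have k4 : 0 ≤ K * (h ^ 3 * M2) := by positivity
  nlinarith

end Local

/-- Discrete Grönwall inequality on a nonuniform grid with third-order local errors. -/
lemma discrete_gronwall_grid_s10 {N : ℕ} {t ε : ℕ → ℝ} {A B H : ℝ} (hA : 0 ≤ A) (hB : 0 ≤ B)
    (ht : ∀ n < N, t n < t (n + 1)) (hH : ∀ n < N, t (n + 1) - t n ≤ H) (h0 : ε 0 = 0)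
    (hstep : ∀ n < N, ε (n + 1) ≤ (1 + A * (t (n + 1) - t n)) * ε n + B * (t (n + 1) - t n) ^ 3) :
    ∀ n ≤ N, 0 ≤ t n - t 0 ∧ ε n ≤ B * H ^ 2 * (t n - t 0) * Real.exp (A * (t n - t 0)) := by
  intro n
  induction n with
  | zero => simp [h0]
  | succ n ih =>
    intro hn
    obtain ⟨ih0, ih1⟩ := ih (by lia)
    have hpos := sub_pos.2 (ht n hn)
    have hle := hH n hn
    have hst := hstep n hn
    have hs : t (n + 1) - t 0 = (t n - t 0) + (t (n + 1) - t n) := by ring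
    rw [hs]
    generalize t (n + 1) - t n = h at *
    generalize t n - t 0 = s at *
    refine ⟨by linarith, hst.trans ?_⟩
    have hexp : (1 + A * h) * Real.exp (A * s) ≤ Real.exp (A * (s + h)) := by
      rw [mul_add, Real.exp_add, mul_comm]
      exact mul_le_mul_of_nonneg_left (by linarith [Real.add_one_le_exp (A * h)])
        (Real.exp_pos _).le
    have hone : 1 ≤ Real.exp (A * (s + h)) := Real.one_le_exp (by positivity)
    calc (1 + A * h) * ε n + B * h ^ 3
        ≤ (1 + A * h) * (B * H ^ 2 * s * Real.exp (A * s)) + B * (H ^ 2 * h) := by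
          gcongr
          rw [pow_succ]
          gcongr
      _ = B * H ^ 2 * s * ((1 + A * h) * Real.exp (A * s)) + B * H ^ 2 * h * 1 := by ring
      _ ≤ B * H ^ 2 * s * Real.exp (A * (s + h)) + B * H ^ 2 * h * Real.exp (A * (s + h)) := by
          gcongr
      _ = B * H ^ 2 * (s + h) * Real.exp (A * (s + h)) := by ring

/-- A bounded nonnegative family is dominated by its supremum over a set. -/
lemma le_biSup_of_forall_le {ι : Type*} {p : ι → Prop} {F : ι → ℝ} {M : ℝ} (hM : 0 ≤ M)
    (hF : ∀ i, p i → F i ≤ M) {i : ι} (hi : p i) : F i ≤ ⨆ (j) (_ : p j), F j := by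
  have hbdd : BddAbove (Set.range fun j => ⨆ _ : p j, F j) := by
    refine ⟨M, ?_⟩
    rintro _ ⟨j, rfl⟩
    exact Real.iSup_le (hF j) hM
  refine le_trans ?_ (le_ciSup hbdd i)
  simp [hi]

/-- **Second-order global error bound for the two-stage RES scheme (Theorem 2).**
There is a constant `C`, depending only on `L`, `c₂` and `λ_max - λ_min` (not on the grid, the
dimension, `g` or `x`), such that for every Lipschitz-in-`x` `g`, every solution `x` of
`dx/dλ = -x + g(x, λ)` with `f(λ) := g(x(λ), λ)` twice continuously differentiable, and every
grid `λ_min = λ_0 < … < λ_N = λ_max`, the two-stage iterates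
`X_0 := x(λ_0)`,
`X_{n,2} := e^{-c₂ h_n} X_n + c₂ h_n φ_1(-c₂ h_n) g(X_n, λ_n)`,
`X_{n+1} := e^{-h_n} X_n + h_n [(φ_1(-h_n) - φ_2(-h_n)/c₂) g(X_n, λ_n)
  + (φ_2(-h_n)/c₂) g(X_{n,2}, λ_n + c₂ h_n)]`
satisfy `‖X_n - x(λ_n)‖ ≤ C h² (sup ‖f'‖ + sup ‖f''‖)` with `h := max_n h_n`. -/
theorem stmt_10 (L c2 lmin lmax : ℝ) (hc2 : c2 ∈ Set.Ioc (0:ℝ) 1) (hlt : lmin < lmax) :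
    ∃ C : ℝ, ∀ (d : ℕ)
      (g : EuclideanSpace ℝ (Fin d) → ℝ → EuclideanSpace ℝ (Fin d))
      (x : ℝ → EuclideanSpace ℝ (Fin d)),
      (∀ (x1 x2 : EuclideanSpace ℝ (Fin d)), ∀ lam ∈ Set.Icc lmin lmax,
        ‖g x1 lam - g x2 lam‖ ≤ L * ‖x1 - x2‖) →
      (∀ lam ∈ Set.Icc lmin lmax,
        HasDerivWithinAt x (-x lam + g (x lam) lam) (Set.Icc lmin lmax) lam) →
      ContDiffOn ℝ 2 (fun lam => g (x lam) lam) (Set.Icc lmin lmax) →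
      ∀ (N : ℕ) (t : ℕ → ℝ), 0 < N → t 0 = lmin → t N = lmax →
      (∀ n < N, t n < t (n + 1)) →
      ∀ X : ℕ → EuclideanSpace ℝ (Fin d), X 0 = x (t 0) →
      (∀ n < N, X (n + 1) = Real.exp (-(t (n + 1) - t n)) • X n +
        (t (n + 1) - t n) •
          ((phi 1 (t (n + 1) - t n) - phi 2 (t (n + 1) - t n) / c2) • g (X n) (t n) +
           (phi 2 (t (n + 1) - t n) / c2) •
             g (Real.exp (-(c2 * (t (n + 1) - t n))) • X n +
                (c2 * (t (n + 1) - t n) * phi 1 (c2 * (t (n + 1) - t n))) • g (X n) (t n))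
               (t n + c2 * (t (n + 1) - t n)))) →
      ∀ n ≤ N, ‖X n - x (t n)‖ ≤
        C * (⨆ m ∈ Finset.range N, (t (m + 1) - t m)) ^ 2 *
          ((⨆ lam ∈ Set.Icc lmin lmax,
              ‖iteratedDerivWithin 1 (fun u => g (x u) u) (Set.Icc lmin lmax) lam‖) +
           (⨆ lam ∈ Set.Icc lmin lmax,
              ‖iteratedDerivWithin 2 (fun u => g (x u) u) (Set.Icc lmin lmax) lam‖)) := by
  set T := lmax - lmin with hT
  set K := |L| with hK
  have hK0 : 0 ≤ K := abs_nonneg L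
  obtain ⟨hc0, hc1⟩ := hc2
  have hT0 : 0 < T := sub_pos.2 hlt
  set A := (1 + 1 / c2) * K + K * (1 + K * T) / c2 with hA
  have hA0 : 0 ≤ A := by positivity
  refine ⟨(K + 2) * T * Real.exp (A * T), ?_⟩
  intro d g x hg hx hf N t hN ht0 htN ht X hX0 hX
  set f : ℝ → EuclideanSpace ℝ (Fin d) := fun u => g (x u) u with hfdef
  set I := Set.Icc lmin lmax with hI
  have hU : UniqueDiffOn ℝ I := uniqueDiffOn_Icc hlt
  have hd : ∀ u ∈ I, HasDerivWithinAt f (iteratedDerivWithin 1 f I u) I u := by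
    intro u hu
    rw [iteratedDerivWithin_one]
    exact (hf.differentiableOn (by norm_num) u hu).hasDerivWithinAt
  have hd1 : ∀ u ∈ I, HasDerivWithinAt (iteratedDerivWithin 1 f I)
      (iteratedDerivWithin 2 f I u) I u := by
    intro u hu
    rw [iteratedDerivWithin_succ (n := 1)]
    exact (hf.differentiableOn_iteratedDerivWithin (m := 1) (by norm_num) hU u hu).hasDerivWithinAt
  have hsup : ∀ m : ℕ, m ≤ 2 → ∀ u ∈ I, ‖iteratedDerivWithin m f I u‖ ≤
      ⨆ lam ∈ I, ‖iteratedDerivWithin m f I lam‖ := by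
    intro m hm u hu
    obtain ⟨M, hM⟩ := isCompact_Icc.exists_bound_of_continuousOn
      (hf.continuousOn_iteratedDerivWithin (m := m) (by exact_mod_cast hm) hU)
    exact le_biSup_of_forall_le (p := fun v => v ∈ I) ((norm_nonneg _).trans (hM u hu)) hM hu
  have hM1 := hsup 1 (by norm_num)
  have hM2 := hsup 2 le_rfl
  set M1 := ⨆ lam ∈ I, ‖iteratedDerivWithin 1 f I lam‖
  set M2 := ⨆ lam ∈ I, ‖iteratedDerivWithin 2 f I lam‖
  have hmem0 : lmin ∈ I := ⟨le_rfl, hlt.le⟩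
  have hM0 : 0 ≤ M1 + M2 :=
    add_nonneg ((norm_nonneg _).trans (hM1 _ hmem0)) ((norm_nonneg _).trans (hM2 _ hmem0))
  have hmono : ∀ i j, i ≤ j → j ≤ N → t i ≤ t j := by
    intro i j hij
    induction j, hij using Nat.le_induction with
    | base => exact fun _ => le_rfl
    | succ j _ ih => exact fun hj => (ih (by lia)).trans (ht j hj).le
  have hlo : ∀ n ≤ N, lmin ≤ t n := fun n hn => ht0 ▸ hmono 0 n n.zero_le hn
  have hhi : ∀ n ≤ N, t n ≤ lmax := fun n hn => htN ▸ hmono n N hn le_rfl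
  have hH : ∀ n < N, t (n + 1) - t n ≤ ⨆ m ∈ Finset.range N, (t (m + 1) - t m) := by
    intro n hn
    refine le_biSup_of_forall_le (p := fun m => m ∈ Finset.range N)
      (F := fun m => t (m + 1) - t m) hT0.le (fun m hm => ?_) (Finset.mem_range.2 hn)
    have hm' := Finset.mem_range.1 hm
    linarith [hlo m hm'.le, hhi (m + 1) hm']
  set H := ⨆ m ∈ Finset.range N, (t (m + 1) - t m)
  have hgrow := discrete_gronwall_grid_s10 (ε := fun n => ‖X n - x (t n)‖)
    (B := (K + 2) * (M1 + M2)) hA0 (by positivity) ht hH (by simp [hX0]) (fun n hn => by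
      have hpos := sub_pos.2 (ht n hn)
      have hend : t n + (t (n + 1) - t n) = t (n + 1) := by ring
      have hsub : Set.Icc (t n) (t n + (t (n + 1) - t n)) ⊆ I := by
        rw [hend]
        exact Set.Icc_subset_Icc (hlo n hn.le) (hhi (n + 1) hn)
      have hs := norm_res_step_sub_le (g := g) (x := x) (T := T) (a := t n) (K := K) hpos
        (by linarith [hlo n hn.le, hhi (n + 1) hn]) hK0 ⟨hc0, hc1⟩
        (fun x1 x2 u hu => (hg x1 x2 u (hsub hu)).trans
          (mul_le_mul_of_nonneg_right (le_abs_self L) (norm_nonneg _)))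
        (fun u hu => (hx u (hsub hu)).mono hsub)
        (fun u hu => (hd u (hsub hu)).mono hsub)
        (fun u hu => (hd1 u (hsub hu)).mono hsub)
        (fun u hu => hM1 u (hsub hu)) (fun u hu => hM2 u (hsub hu)) (X n)
      rw [hend, ← hX n hn] at hs
      exact hs.trans_eq (by ring))
  intro n hn
  obtain ⟨h0, h1⟩ := hgrow n hn
  have hle : t n - t 0 ≤ T := by linarith [hhi n hn]
  calc ‖X n - x (t n)‖
      ≤ (K + 2) * (M1 + M2) * H ^ 2 * (t n - t 0) * Real.exp (A * (t n - t 0)) := h1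
    _ ≤ (K + 2) * (M1 + M2) * H ^ 2 * T * Real.exp (A * T) := by gcongr
    _ = (K + 2) * T * Real.exp (A * T) * H ^ 2 * (M1 + M2) := by ring
end

section
/- For every h > 0, one has φ_2(−h) − φ_1(−h)/2 > 0, equivalently h − 2 + (h + 2) e^{−h} > 0. Consequently, for any c₂ ∈ (0,1], the DPM-Solver++ weight choice b_2 = φ_1(−h)/(2 c₂) violates the second-order condition: ψ_2(−h) = φ_2(−h) − b_2 c₂ = φ_2(−h) − φ_1(−h)/2 ≠ 0. -/
open MeasureTheory

theorem phi_one {h : ℝ} (hh : h ≠ 0) : phi 1 h = (1 - Real.exp (-h)) / h := by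
  have hderiv : ∀ τ ∈ Set.uIcc 0 h,
      HasDerivAt (fun τ : ℝ => Real.exp (τ - h)) (Real.exp (τ - h)) τ := fun τ _ => by
    simpa using ((hasDerivAt_id τ).sub_const h).exp
  have hint := intervalIntegral.integral_eq_sub_of_hasDerivAt hderiv
    (Continuous.intervalIntegrable (by fun_prop) _ _)
  simp only [sub_self, Real.exp_zero, zero_sub] at hint
  simp [phi, hh, -intervalIntegral.integral_comp_sub_right, hint]
  field_simp

theorem phi_two {h : ℝ} (hh : h ≠ 0) : phi 2 h = (h - 1 + Real.exp (-h)) / h ^ 2 := by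
  have hderiv : ∀ τ ∈ Set.uIcc 0 h,
      HasDerivAt (fun τ : ℝ => Real.exp (τ - h) * (τ - 1)) (Real.exp (τ - h) * τ) τ :=
    fun τ _ => by
      refine (((hasDerivAt_id' τ).sub_const h).exp.mul
        ((hasDerivAt_id' τ).sub_const 1)).congr_deriv ?_
      ring
  have hint := intervalIntegral.integral_eq_sub_of_hasDerivAt hderiv
    (Continuous.intervalIntegrable (by fun_prop) _ _)
  simp only [sub_self, Real.exp_zero, zero_sub] at hint
  simp [phi, hh, hint]
  field_simp

theorem sub_two_add_mul_exp_neg_pos {h : ℝ} (hh : 0 < h) :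
    0 < h - 2 + (h + 2) * Real.exp (-h) := by
  have hderiv (x : ℝ) : HasDerivAt (fun x : ℝ => x - 2 + (x + 2) * Real.exp (-x))
      (1 - (x + 1) * Real.exp (-x)) x := by
    refine (((hasDerivAt_id' x).sub_const 2).add
      (((hasDerivAt_id' x).add_const 2).mul (hasDerivAt_neg' x).exp)).congr_deriv ?_
    ring
  have hmono : StrictMonoOn (fun x : ℝ => x - 2 + (x + 2) * Real.exp (-x)) (Set.Ici 0) := by
    refine strictMonoOn_of_deriv_pos (convex_Ici 0) (by fun_prop) fun x hx => ?_
    rw [interior_Ici, Set.mem_Ioi] at hx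
    rw [(hderiv x).deriv, sub_pos, Real.exp_neg, ← div_eq_mul_inv, div_lt_one (Real.exp_pos x)]
    exact Real.add_one_lt_exp hx.ne'
  simpa using hmono Set.self_mem_Ici hh.le hh

/-- **DPM-Solver++ violates the second-order condition.**
For every `h > 0`, `φ_2(-h) - φ_1(-h)/2 > 0`, equivalently `h - 2 + (h + 2) e^{-h} > 0`.
Consequently for any `c₂ ∈ (0,1]`, the DPM-Solver++ weight `b_2 = φ_1(-h)/(2c₂)` gives
`ψ_2(-h) = φ_2(-h) - b_2 c₂ = φ_2(-h) - φ_1(-h)/2 ≠ 0`. -/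
theorem stmt_13 (h : ℝ) (hh : 0 < h) :
    (0 < phi 2 h - phi 1 h / 2 ∧ 0 < h - 2 + (h + 2) * Real.exp (-h)) ∧
    ∀ c2 ∈ Set.Ioc (0:ℝ) 1,
      phi 2 h - (phi 1 h / (2 * c2)) * c2 = phi 2 h - phi 1 h / 2 ∧
      phi 2 h - (phi 1 h / (2 * c2)) * c2 ≠ 0 := by
  have hexp := sub_two_add_mul_exp_neg_pos hh
  have hphi : 0 < phi 2 h - phi 1 h / 2 := by
    have heq : phi 2 h - phi 1 h / 2 = (h - 2 + (h + 2) * Real.exp (-h)) / (2 * h ^ 2) := by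
      rw [phi_one hh.ne', phi_two hh.ne']
      field_simp
      ring
    rw [heq]
    positivity
  refine ⟨⟨hphi, hexp⟩, fun c2 hc2 => ?_⟩
  have hweight : phi 1 h / (2 * c2) * c2 = phi 1 h / 2 := by
    have := hc2.1.ne'
    field_simp
  rw [hweight]
  exact ⟨rfl, hphi.ne'⟩
end
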